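/- arXiv:1511.08021 — 6 statements merged into one kernel-verified Lean document; each statement's English description precedes it below -/
import Mathlib

section
/- Suppose A is continuously differentiable, B and C are continuous, A, B, C are all T-periodic with T > 0, and -A(t)C(t) > 0 for every real t. Then there exists a T-periodic solution Q₊ : ℝ → ℝ of the Riccati equation Q'(t) = A(t)Q(t)² + B(t)Q(t) + C(t) with Q₊(t) > 0 for all t. -/
open scoped BoundedContinuousFunction in
/-- Periodic solution of `u' = h t u - l u` by Banach's fixed point theorem. -/
theorem aux_fixed (h : ℝ → ℝ → ℝ) (T l k R : ℝ) (hT : 0 < T) (hl : 0 < l) (hk0 : 0 ≤ k)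
    (hk : k < l) (hc : Continuous (Function.uncurry h)) (hper : ∀ t u, h (t + T) u = h t u)
    (hlip : ∀ t u v, |h t u - h t v| ≤ k * |u - v|) (hbd : ∀ t u, |h t u| ≤ l * R) :
    ∃ u : ℝ → ℝ, (∀ t, HasDerivAt u (h t (u t) - l * u t) t) ∧ Function.Periodic u T ∧
      ∀ t, |u t| ≤ R := by
  have hE : 0 < Real.exp (l * T) - 1 := by
    have := Real.add_one_lt_exp (x := l * T) (by positivity)
    have : 0 < l * T := by positivity
    linarith
  set E := Real.exp (l * T) - 1 with hEdef
  let P : (ℝ → ℝ) → ℝ → ℝ := fun g t => ∫ s in (0:ℝ)..t, Real.exp (l * s) * g s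
  let K : (ℝ → ℝ) → ℝ → ℝ := fun g t => E⁻¹ * Real.exp (-(l * t)) * (P g (t + T) - P g t)
  have hcont : ∀ g : ℝ → ℝ, Continuous g → Continuous fun s => Real.exp (l * s) * g s := by
    intro g hg; fun_prop
  have hP : ∀ g : ℝ → ℝ, Continuous g → ∀ t, HasDerivAt (P g) (Real.exp (l * t) * g t) t := by
    intro g hg t
    exact intervalIntegral.integral_hasDerivAt_right ((hcont g hg).intervalIntegrable _ _)
      ((hcont g hg).stronglyMeasurableAtFilter _ _) (hcont g hg).continuousAt
  have hKd : ∀ g : ℝ → ℝ, Continuous g → ∀ t, HasDerivAt (K g)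
      (E⁻¹ * (Real.exp (l * T) * g (t + T) - g t) - l * K g t) t := by
    intro g hg t
    have h1 : HasDerivAt (fun t => P g (t + T)) (Real.exp (l * (t + T)) * g (t + T)) t :=
      (hP g hg (t + T)).comp_add_const t T
    have h2 : HasDerivAt (fun t : ℝ => Real.exp (-(l * t))) (Real.exp (-(l * t)) * (-(l * 1))) t :=
      (((hasDerivAt_id t).const_mul l).neg).exp
    have h3 := (h2.const_mul E⁻¹).mul (h1.sub (hP g hg t))
    refine h3.congr_deriv ?_
    have e1 : Real.exp (l * (t + T)) = Real.exp (l * t) * Real.exp (l * T) := by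
      rw [← Real.exp_add]; ring_nf
    have e2 : Real.exp (-(l * t)) * Real.exp (l * t) = 1 := by
      rw [← Real.exp_add]; simp
    simp only [K, Pi.sub_apply]
    rw [e1]
    linear_combination (E⁻¹ * (Real.exp (l * T) * g (t + T) - g t)) * e2
  have hKsub : ∀ g : ℝ → ℝ, Continuous g → ∀ t, K g t =
      E⁻¹ * Real.exp (-(l * t)) * ∫ s in t..(t + T), Real.exp (l * s) * g s := by
    intro g hg t
    simp only [K, P]
    rw [intervalIntegral.integral_interval_sub_left ((hcont g hg).intervalIntegrable _ _)
      ((hcont g hg).intervalIntegrable _ _)]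
  have hKlin : ∀ g₁ g₂ : ℝ → ℝ, Continuous g₁ → Continuous g₂ → ∀ t,
      K g₁ t - K g₂ t = K (fun s => g₁ s - g₂ s) t := by
    intro g₁ g₂ h1 h2 t
    rw [hKsub _ h1, hKsub _ h2, hKsub (fun s => g₁ s - g₂ s) (h1.sub h2), ← mul_sub, ← intervalIntegral.integral_sub
      ((hcont _ h1).intervalIntegrable _ _) ((hcont _ h2).intervalIntegrable _ _)]
    simp only [mul_sub]
  have hmass : ∀ t, E⁻¹ * Real.exp (-(l * t)) * ∫ s in t..(t + T), Real.exp (l * s) = l⁻¹ := by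
    intro t
    have : ∫ s in t..(t + T), Real.exp (l * s)
        = Real.exp (l * (t + T)) / l - Real.exp (l * t) / l := by
      refine intervalIntegral.integral_eq_sub_of_hasDerivAt
        (f := fun s => Real.exp (l * s) / l) ?_ ?_
      · intro x _
        have := ((((hasDerivAt_id x).const_mul l).exp).div_const l)
        refine this.congr_deriv ?_
        simp only [id]
        field_simp
      · exact Continuous.intervalIntegrable (by fun_prop) _ _
    have e1 : Real.exp (l * (t + T)) = Real.exp (l * t) * Real.exp (l * T) := by
      rw [← Real.exp_add]; ring_nf
    have e2 : Real.exp (-(l * t)) * Real.exp (l * t) = 1 := by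
      rw [← Real.exp_add]; simp
    rw [this, e1]
    have e3 : E⁻¹ * (Real.exp (l * T) - 1) = 1 := inv_mul_cancel₀ hE.ne'
    rw [div_eq_mul_inv, div_eq_mul_inv]
    linear_combination (E⁻¹ * (Real.exp (l * T) - 1) * l⁻¹) * e2 + l⁻¹ * e3
  have hKbd : ∀ g : ℝ → ℝ, Continuous g → ∀ M, (∀ s, |g s| ≤ M) → ∀ t, |K g t| ≤ M / l := by
    intro g hg M hM t
    have hpos : 0 < E⁻¹ * Real.exp (-(l * t)) := by positivity
    rw [hKsub g hg, abs_mul, abs_of_pos hpos]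
    have : |∫ s in t..(t + T), Real.exp (l * s) * g s| ≤ ∫ s in t..(t + T), Real.exp (l * s) * M := by
      refine (intervalIntegral.abs_integral_le_integral_abs (by linarith)).trans ?_
      refine intervalIntegral.integral_mono_on (by linarith)
        ((hcont g hg).abs.intervalIntegrable _ _)
        (Continuous.intervalIntegrable (by fun_prop) _ _) ?_
      intro s _
      rw [abs_mul, abs_of_pos (Real.exp_pos _)]
      exact mul_le_mul_of_nonneg_left (hM s) (Real.exp_pos _).le
    refine (mul_le_mul_of_nonneg_left this hpos.le).trans ?_
    rw [intervalIntegral.integral_mul_const, ← mul_assoc, hmass, div_eq_inv_mul]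
  have hKc : ∀ g : ℝ → ℝ, Continuous g → Continuous (K g) := fun g hg =>
    continuous_iff_continuousAt.2 fun t => (hKd g hg t).continuousAt
  have hgc : ∀ u : ℝ →ᵇ ℝ, Continuous fun s => h s (u s) := fun u =>
    hc.comp (continuous_id.prodMk u.continuous)
  let Φ : (ℝ →ᵇ ℝ) → (ℝ →ᵇ ℝ) := fun u =>
    BoundedContinuousFunction.ofNormedAddCommGroup (K fun s => h s (u s)) (hKc _ (hgc u))
      (l * R / l) (fun t => hKbd _ (hgc u) _ (fun s => hbd s _) t)
  have hΦ : ∀ u t, Φ u t = K (fun s => h s (u s)) t := fun _ _ => rfl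
  have hcontr : ContractingWith (Real.toNNReal (k / l)) Φ := by
    constructor
    · rw [Real.toNNReal_lt_one, div_lt_one hl]; exact hk
    · refine LipschitzWith.of_dist_le_mul fun u v => ?_
      rw [Real.coe_toNNReal _ (by positivity)]
      refine (BoundedContinuousFunction.dist_le (by positivity)).2 fun t => ?_
      rw [hΦ, hΦ, Real.dist_eq, hKlin _ _ (hgc u) (hgc v)]
      refine (hKbd _ ((hgc u).sub (hgc v)) (k * dist u v) (fun s => ?_) t).trans_eq (by ring)
      refine (hlip _ _ _).trans (mul_le_mul_of_nonneg_left ?_ hk0)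
      rw [← Real.dist_eq]
      exact BoundedContinuousFunction.dist_coe_le_dist s
  obtain ⟨u, hu⟩ : ∃ u, Φ u = u := ⟨_, hcontr.fixedPoint_isFixedPt⟩
  have huK : ∀ t, u t = K (fun s => h s (u s)) t := fun t => by rw [← hΦ, hu]
  let w : ℝ →ᵇ ℝ := u.compContinuous ⟨fun t => t + T, by fun_prop⟩
  have hw : ∀ t, w t = u (t + T) := fun _ => rfl
  have hwfix : Φ w = w := by
    ext t
    rw [hΦ, hw, huK, hKsub _ (hgc u), hKsub _ (hgc w)]
    have := intervalIntegral.integral_comp_add_right (a := t) (b := t + T)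
      (fun s => Real.exp (l * s) * h s (u s)) T
    rw [← this]
    have e : ∀ s, Real.exp (l * (s + T)) * h (s + T) (u (s + T))
        = Real.exp (l * T) * (Real.exp (l * s) * h s (w s)) := by
      intro s
      rw [hper, hw, mul_add, Real.exp_add]; ring
    simp only [e, intervalIntegral.integral_const_mul]
    have e4 : Real.exp (-(l * (t + T))) * Real.exp (l * T) = Real.exp (-(l * t)) := by
      rw [← Real.exp_add]; ring_nf
    rw [← e4]; ring
  have hwu : w = u := hcontr.fixedPoint_unique' hwfix hu
  have hup : ∀ t, u (t + T) = u t := fun t => by rw [← hw, hwu]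
  refine ⟨u, fun t => ?_, hup, fun t => ?_⟩
  · have h1 := hKd _ (hgc u) t
    have h2 : (K fun s => h s (u s)) = u := funext fun t => (huK t).symm
    rw [h2] at h1
    refine h1.congr_deriv ?_
    simp only [hper, hup]
    have e3 : E⁻¹ * (Real.exp (l * T) - 1) = 1 := inv_mul_cancel₀ hE.ne'
    linear_combination h t (u t) * e3
  · rw [huK]
    refine (hKbd _ (hgc u) _ (fun s => hbd s _) t).trans_eq ?_
    field_simp

theorem aux_bound (f : ℝ → ℝ) (T : ℝ) (hT : 0 < T) (hf : Continuous f)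
    (hp : Function.Periodic f T) : ∃ x, ∀ t, f x ≤ f t := by
  obtain ⟨x, -, hx⟩ := (isCompact_Icc (a := (0:ℝ)) (b := T)).exists_isMinOn
    ⟨0, by simp [hT.le]⟩ hf.continuousOn
  refine ⟨x, fun t => ?_⟩
  obtain ⟨y, hy, hyt⟩ := hp.exists_mem_Ico₀ hT t
  rw [hyt]
  exact hx (Set.Ico_subset_Icc_self hy)

theorem aux_neg
    (A B C : ℝ → ℝ) (T : ℝ) (hT : 0 < T)
    (hA : Continuous A) (hB : Continuous B) (hC : Continuous C)
    (hAper : Function.Periodic A T) (hBper : Function.Periodic B T)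
    (hCper : Function.Periodic C T)
    (hA0 : ∀ t, A t < 0) (hC0 : ∀ t, 0 < C t) :
    ∃ Qp : ℝ → ℝ,
      (∀ t : ℝ, HasDerivAt Qp (A t * Qp t ^ 2 + B t * Qp t + C t) t) ∧
      Function.Periodic Qp T ∧ (∀ t : ℝ, 0 < Qp t) := by
  obtain ⟨m, M, hm, hAm, hCm, hAM, hBM, hCM⟩ : ∃ m M : ℝ, 0 < m ∧ (∀ t, m ≤ -A t) ∧
      (∀ t, m ≤ C t) ∧ (∀ t, -A t ≤ M) ∧ (∀ t, |B t| ≤ M) ∧ (∀ t, C t ≤ M) := by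
    obtain ⟨x1, h1⟩ := aux_bound (fun t => -A t) T hT hA.neg (fun t => by simp [hAper t])
    obtain ⟨x2, h2⟩ := aux_bound C T hT hC hCper
    obtain ⟨x3, h3⟩ := aux_bound A T hT hA hAper
    obtain ⟨x4, h4⟩ := aux_bound (fun t => -C t) T hT hC.neg (fun t => by simp [hCper t])
    obtain ⟨x5, h5⟩ := aux_bound (fun t => -|B t|) T hT hB.abs.neg (fun t => by simp [hBper t])
    refine ⟨min (-A x1) (C x2), max (-A x3) (max (C x4) |B x5|), ?_, ?_, ?_, ?_, ?_, ?_⟩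
    · exact lt_min (by linarith [hA0 x1]) (hC0 _)
    · exact fun t => (min_le_left _ _).trans (h1 t)
    · exact fun t => (min_le_right _ _).trans (h2 t)
    · exact fun t => le_max_of_le_left (by linarith [h3 t])
    · exact fun t => le_max_of_le_right (le_max_of_le_right (by linarith [h5 t]))
    · exact fun t => le_max_of_le_right (le_max_of_le_left (by linarith [h4 t]))
  have hmM : m ≤ M := (hCm 0).trans (hCM 0)
  have hM : 0 < M := by linarith
  set R := Real.log (2 * M / m) with hR
  have heR : Real.exp R = 2 * M / m := Real.exp_log (by positivity)
  have hme : m * Real.exp R = 2 * M := by rw [heR]; field_simp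
  have hR0 : 0 ≤ R := Real.log_nonneg (by rw [le_div_iff₀ hm]; linarith)
  have heR1 : Real.exp (-R) ≤ 1 := Real.exp_le_one_iff.2 (by linarith)
  have heR2 : 1 ≤ Real.exp R := Real.one_le_exp hR0
  have hen : 0 < Real.exp (-R) := Real.exp_pos _
  set l := 2 * M * Real.exp R with hl
  set d := m * Real.exp (-R) with hd
  let F : ℝ → ℝ → ℝ := fun t u => A t * Real.exp u + B t + C t * Real.exp (-u)
  let cl : ℝ → ℝ := fun u => max (-R) (min R u)
  let h : ℝ → ℝ → ℝ := fun t u => F t (cl u) + l * cl u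
  have hcl1 : ∀ u, -R ≤ cl u := fun u => le_max_left _ _
  have hcl2 : ∀ u, cl u ≤ R := fun u => max_le (by linarith) (min_le_left _ _)
  have hcll : ∀ u v, |cl u - cl v| ≤ |u - v| := by
    intro u v
    refine (abs_max_sub_max_le_max _ _ _ _).trans ?_
    simp only [sub_self, abs_zero]
    refine max_le (abs_nonneg _) ((abs_min_sub_min_le_max _ _ _ _).trans ?_)
    simp
  have hclm : ∀ u, |u| ≤ R → cl u = u := by
    intro u hu
    have := abs_le.1 hu
    simp only [cl]
    rw [min_eq_right this.2, max_eq_right this.1]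
  -- exponential difference estimates
  have hexp : ∀ u v, -R ≤ v → v ≤ u → u ≤ R →
      Real.exp (-R) * (u - v) ≤ Real.exp u - Real.exp v ∧
      Real.exp u - Real.exp v ≤ Real.exp R * (u - v) := by
    intro u v h1 h2 h3
    have a1 : Real.exp u = Real.exp v * Real.exp (u - v) := by rw [← Real.exp_add]; ring_nf
    have a2 : Real.exp v = Real.exp u * Real.exp (v - u) := by rw [← Real.exp_add]; ring_nf
    have a3 := Real.add_one_le_exp (u - v)
    have a4 := Real.add_one_le_exp (v - u)
    have a5 : Real.exp (-R) ≤ Real.exp v := Real.exp_le_exp.2 h1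
    have a6 : Real.exp u ≤ Real.exp R := Real.exp_le_exp.2 h3
    have a7 := Real.exp_pos u
    have a8 := Real.exp_pos v
    constructor
    · nlinarith [mul_le_mul_of_nonneg_left a3 a8.le, mul_le_mul_of_nonneg_right a5 (sub_nonneg.2 h2)]
    · nlinarith [mul_le_mul_of_nonneg_left a4 a7.le, mul_le_mul_of_nonneg_right a6 (sub_nonneg.2 h2)]
  have hF : ∀ t u v, -R ≤ v → v ≤ u → u ≤ R →
      d * (u - v) ≤ F t v - F t u ∧ F t v - F t u ≤ l * (u - v) := by
    intro t u v h1 h2 h3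
    obtain ⟨p1, p2⟩ := hexp u v h1 h2 h3
    obtain ⟨q1, q2⟩ := hexp (-v) (-u) (by linarith) (by linarith) (by linarith)
    have huv : 0 ≤ u - v := by linarith
    have hq : 0 ≤ Real.exp (-v) - Real.exp (-u) := by
      refine le_trans ?_ q1
      exact mul_nonneg hen.le (by linarith)
    have hp : 0 ≤ Real.exp u - Real.exp v := le_trans (by positivity) p1
    have e : F t v - F t u = (-A t) * (Real.exp u - Real.exp v)
      + C t * (Real.exp (-v) - Real.exp (-u)) := by simp only [F]; ring
    rw [e]
    constructor
    · have b1 := mul_le_mul_of_nonneg_right (hAm t) hp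
      have b2 := mul_le_mul_of_nonneg_left p1 hm.le
      have b3 := mul_nonneg (hC0 t).le hq
      rw [hd]; linarith
    · have b1 := mul_le_mul_of_nonneg_right (hAM t) hp
      have b2 := mul_le_mul_of_nonneg_left p2 hM.le
      have b3 := mul_le_mul_of_nonneg_right (hCM t) hq
      have b4 := mul_le_mul_of_nonneg_left q2 hM.le
      rw [hl]; linarith
  have hd0 : 0 < d := by positivity
  have hdl : d ≤ l := by
    rw [hd, hl]
    nlinarith [mul_le_mul_of_nonneg_left heR1 hm.le, mul_le_mul_of_nonneg_left heR2 hM.le]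
  have hl0 : 0 < l := by positivity
  have hFR : ∀ t, F t R ≤ 0 := by
    intro t
    have b1 := mul_le_mul_of_nonneg_right (hAm t) (Real.exp_pos R).le
    have b2 := mul_le_mul_of_nonneg_right (hCM t) hen.le
    have b3 := mul_le_mul_of_nonneg_left heR1 hM.le
    have b4 := (abs_le.1 (hBM t)).2
    simp only [F]; linarith
  have hFR' : ∀ t, 0 ≤ F t (-R) := by
    intro t
    have b1 := mul_le_mul_of_nonneg_right (hCm t) (Real.exp_pos R).le
    have b2 := mul_le_mul_of_nonneg_right (hAM t) hen.le
    have b3 := mul_le_mul_of_nonneg_left heR1 hM.le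
    have b4 := (abs_le.1 (hBM t)).1
    simp only [F, neg_neg]; linarith
  obtain ⟨u, hu1, hu2, hu3⟩ := aux_fixed h T l (l - d) R hT hl0 (by linarith) (by linarith)
    (by simp only [h, F, cl]; fun_prop)
    (by intro t u; simp only [h, F, hAper t, hBper t, hCper t])
    (by
      intro t u v
      refine le_trans ?_ (mul_le_mul_of_nonneg_left (hcll u v) (by linarith))
      simp only [h]
      rcases le_total (cl v) (cl u) with hh | hh
      · obtain ⟨p, q⟩ := hF t _ _ (hcl1 v) hh (hcl2 u)
        rw [abs_of_nonneg (sub_nonneg.2 hh), abs_le]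
        have := mul_nonneg (sub_nonneg.2 hdl) (sub_nonneg.2 hh)
        constructor <;> linarith
      · obtain ⟨p, q⟩ := hF t _ _ (hcl1 u) hh (hcl2 v)
        rw [abs_sub_comm (cl u), abs_of_nonneg (sub_nonneg.2 hh), abs_le]
        have := mul_nonneg (sub_nonneg.2 hdl) (sub_nonneg.2 hh)
        constructor <;> linarith)
    (by
      intro t u
      have h1 := (hF t R (cl u) (hcl1 u) (hcl2 u) le_rfl).2
      have h2 := (hF t (cl u) (-R) le_rfl (hcl1 u) (hcl2 u)).2
      have h3 := hFR t
      have h4 := hFR' t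
      simp only [h]
      rw [abs_le]
      constructor <;> linarith)
  refine ⟨fun t => Real.exp (u t), fun t => ?_, fun t => ?_, fun t => Real.exp_pos _⟩
  · refine (hu1 t).exp.congr_deriv ?_
    simp only [h, F, hclm _ (hu3 t)]
    have e2 : Real.exp (u t) * Real.exp (-u t) = 1 := by
      rw [← Real.exp_add]; simp
    linear_combination C t * e2
  · simp only [hu2 t]

/-- Kotin's theorem (existence part): under the stated hypotheses the periodic
Riccati equation has a positive `T`-periodic solution. -/
theorem riccati_exists_positive_periodic_solution
    (A B C : ℝ → ℝ) (T : ℝ) (hT : 0 < T)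
    (hA : ContDiff ℝ 1 A) (hB : Continuous B) (hC : Continuous C)
    (hAper : Function.Periodic A T) (hBper : Function.Periodic B T)
    (hCper : Function.Periodic C T)
    (hAC : ∀ t : ℝ, 0 < -(A t * C t)) :
    ∃ Qp : ℝ → ℝ,
      (∀ t : ℝ, HasDerivAt Qp (A t * Qp t ^ 2 + B t * Qp t + C t) t) ∧
      Function.Periodic Qp T ∧ (∀ t : ℝ, 0 < Qp t) := by
  have hAc : Continuous A := hA.continuous
  have hne : ∀ t, A t ≠ 0 := fun t h0 => by have := hAC t; simp [h0] at this
  by_cases hneg : ∀ t, A t < 0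
  · exact aux_neg A B C T hT hAc hB hC hAper hBper hCper hneg fun t => by
      have := hAC t; have := hneg t; nlinarith
  · push Not at hneg
    obtain ⟨t0, ht0⟩ := hneg
    have hpos : ∀ t, 0 < A t := by
      intro t
      by_contra hh
      obtain ⟨x, hx⟩ := mem_range_of_exists_le_of_exists_ge hAc ⟨t, not_lt.1 hh⟩ ⟨t0, ht0⟩
      exact hne x hx
    have hCneg : ∀ t, C t < 0 := fun t => by
      have := hAC t; have := hpos t; nlinarith
    have hrev : ∀ f : ℝ → ℝ, Function.Periodic f T →
        Function.Periodic (fun t => -f (-t)) T := by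
      intro f hf t
      have := hf (-(t + T))
      simp only [neg_add_rev, neg_add_cancel_comm] at this ⊢
      rw [← this]
    obtain ⟨Q, h1, h2, h3⟩ := aux_neg (fun t => -A (-t)) (fun t => -B (-t)) (fun t => -C (-t)) T hT
      (by fun_prop) (by fun_prop) (by fun_prop) (hrev A hAper) (hrev B hBper) (hrev C hCper)
      (fun t => by linarith [hpos (-t)]) (fun t => by linarith [hCneg (-t)])
    refine ⟨fun t => Q (-t), fun t => ?_, fun t => ?_, fun t => h3 _⟩
    · have := (h1 (-t)).scomp t (hasDerivAt_neg t)
      refine this.congr_deriv ?_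
      simp only [neg_neg, smul_eq_mul]; ring
    · have := h2 (-(t + T))
      simp only
      rw [← this]; congr 1; ring
end

section
/- Suppose A is continuously differentiable, B and C are continuous, A, B, C are all T-periodic with T > 0, and -A(t)C(t) > 0 for every real t. If Q₁ and Q₂ are two T-periodic solutions of the Riccati equation Q'(t) = A(t)Q(t)² + B(t)Q(t) + C(t) with Q₁(t) > 0 and Q₂(t) > 0 for all t, then Q₁ = Q₂. -/
theorem riccati_aux_le
    (A B C : ℝ → ℝ) (T : ℝ) (hT : 0 < T)
    (hAC : ∀ t : ℝ, 0 < -(A t * C t))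
    (P Q : ℝ → ℝ)
    (hP : ∀ t : ℝ, HasDerivAt P (A t * P t ^ 2 + B t * P t + C t) t)
    (hQ : ∀ t : ℝ, HasDerivAt Q (A t * Q t ^ 2 + B t * Q t + C t) t)
    (hPper : Function.Periodic P T) (hQper : Function.Periodic Q T)
    (hPpos : ∀ t : ℝ, 0 < P t) (hQpos : ∀ t : ℝ, 0 < Q t) (s : ℝ) :
    P s ≤ Q s := by
  have hd := fun t => (hP t).div (hQ t) (hQpos t).ne'
  have hper : Function.Periodic (P / Q) T := hPper.div hQper
  have hc : Continuous (P / Q) := continuous_iff_continuousAt.2 fun t => (hd t).continuousAt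
  obtain ⟨m, -, hm⟩ := isCompact_Icc.exists_isMaxOn (Set.nonempty_Icc.2 hT.le) hc.continuousOn
  have hmax : ∀ t, (P / Q) t ≤ (P / Q) m := by
    intro t
    obtain ⟨y, hy, hty⟩ := hper.exists_mem_Ico₀ hT t
    rw [hty]
    exact hm (Set.Ico_subset_Icc_self hy)
  have h0 := IsLocalMax.hasDerivAt_eq_zero (Filter.Eventually.of_forall hmax) (hd m)
  have hq := hQpos m
  have hp := hPpos m
  rw [div_eq_zero_iff, or_iff_left (by positivity)] at h0
  have h1 : (P m - Q m) * (A m ^ 2 * (P m * Q m) + -(A m * C m)) = 0 := by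
    linear_combination A m * h0
  have h2 : 0 < A m ^ 2 * (P m * Q m) + -(A m * C m) :=
    add_pos_of_nonneg_of_pos (by positivity) (hAC m)
  have h3 : P m = Q m := sub_eq_zero.1 ((mul_eq_zero.1 h1).resolve_right h2.ne')
  have h4 := hmax s
  simp only [Pi.div_apply] at h4
  rw [h3, div_self hq.ne', div_le_one (hQpos s)] at h4
  exact h4

/-- Kotin's theorem (uniqueness of the positive periodic solution): two positive
`T`-periodic solutions of the Riccati equation coincide. -/
theorem riccati_positive_periodic_solution_unique
    (A B C : ℝ → ℝ) (T : ℝ) (hT : 0 < T)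
    (hA : ContDiff ℝ 1 A) (hB : Continuous B) (hC : Continuous C)
    (hAper : Function.Periodic A T) (hBper : Function.Periodic B T)
    (hCper : Function.Periodic C T)
    (hAC : ∀ t : ℝ, 0 < -(A t * C t))
    (Q₁ Q₂ : ℝ → ℝ)
    (hQ₁ : ∀ t : ℝ, HasDerivAt Q₁ (A t * Q₁ t ^ 2 + B t * Q₁ t + C t) t)
    (hQ₂ : ∀ t : ℝ, HasDerivAt Q₂ (A t * Q₂ t ^ 2 + B t * Q₂ t + C t) t)
    (hQ₁per : Function.Periodic Q₁ T) (hQ₂per : Function.Periodic Q₂ T)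
    (hQ₁pos : ∀ t : ℝ, 0 < Q₁ t) (hQ₂pos : ∀ t : ℝ, 0 < Q₂ t) :
    Q₁ = Q₂ := by
  funext s
  exact le_antisymm
    (riccati_aux_le A B C T hT hAC Q₁ Q₂ hQ₁ hQ₂ hQ₁per hQ₂per hQ₁pos hQ₂pos s)
    (riccati_aux_le A B C T hT hAC Q₂ Q₁ hQ₂ hQ₁ hQ₂per hQ₁per hQ₂pos hQ₁pos s)
end

section
/- Suppose A is continuously differentiable, B and C are continuous, A, B, C are all T-periodic with T > 0, and -A(t)C(t) > 0 for every real t. Then there exists exactly one T-periodic solution Q₋ : ℝ → ℝ of the Riccati equation Q'(t) = A(t)Q(t)² + B(t)Q(t) + C(t) with Q₋(t) < 0 for all t. -/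
open Set Filter Topology

lemma riccati_glue (A B C q : ℝ → ℝ) (T : ℝ) (hT : 0 < T)
    (hA : Continuous A) (hB : Continuous B) (hC : Continuous C)
    (hAper : Function.Periodic A T) (hBper : Function.Periodic B T)
    (hCper : Function.Periodic C T)
    (hq : ∀ t ∈ Icc 0 T, HasDerivWithinAt q (A t * q t ^ 2 + B t * q t + C t) (Icc 0 T) t)
    (h0 : q 0 = q T) :
    ∃ Q : ℝ → ℝ, (∀ t : ℝ, HasDerivAt Q (A t * Q t ^ 2 + B t * Q t + C t) t) ∧
      Function.Periodic Q T ∧ ∀ t ∈ Icc 0 T, Q t = q t := by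
  haveI : Fact (0 < T) := ⟨hT⟩
  have hqc : ContinuousOn q (Icc 0 T) := fun t ht => (hq t ht).continuousWithinAt
  set Q : ℝ → ℝ := fun t => AddCircle.liftIco T 0 q (t : AddCircle T) with hQ
  have hQc : Continuous Q :=
    (AddCircle.liftIco_zero_continuous h0 hqc).comp (AddCircle.continuous_mk' T)
  have hQp : Function.Periodic Q T := by
    intro t; simp [hQ]
  have hQq : ∀ t ∈ Icc 0 T, Q t = q t := by
    intro t ht
    rcases eq_or_lt_of_le ht.2 with h | h
    · rw [h, ← h0]
      have : Q T = Q 0 := by simpa using hQp 0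
      rw [this]
      exact AddCircle.liftIco_coe_apply (by simp [hT])
    · exact AddCircle.liftIco_coe_apply (by simpa using ⟨ht.1, h⟩)
  set G : ℝ → ℝ := fun t => A t * Q t ^ 2 + B t * Q t + C t with hG
  have hGc : Continuous G := by fun_prop
  have hGp : Function.Periodic G T := by
    intro t; simp only [hG, hAper t, hBper t, hCper t, hQp t]
  set H : ℝ → ℝ := fun t => q 0 + ∫ s in (0:ℝ)..t, G s with hH
  have hHd : ∀ t, HasDerivAt H (G t) t := fun t =>
    (intervalIntegral.integral_hasDerivAt_right (hGc.intervalIntegrable _ _)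
      (hGc.stronglyMeasurableAtFilter _ _) hGc.continuousAt).const_add _
  have hHq : ∀ t ∈ Icc 0 T, H t = q t := by
    intro t ht
    have : ∫ s in (0:ℝ)..t, G s = q t - q 0 := by
      apply intervalIntegral.integral_eq_sub_of_hasDeriv_right_of_le ht.1
        (hqc.mono (Icc_subset_Icc_right ht.2)) _ (hGc.intervalIntegrable _ _)
      intro x hx
      have hx' : x ∈ Icc 0 T := ⟨hx.1.le, hx.2.le.trans ht.2⟩
      have := hq x hx'
      rw [← hQq x hx'] at this
      exact (this.hasDerivAt (Icc_mem_nhds hx.1 (hx.2.trans_le ht.2))).hasDerivWithinAt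
    simp [hH, this]
  have hHp : Function.Periodic H T := by
    intro t
    have h1 : ∫ s in t..t+T, G s = 0 := by
      rw [hGp.intervalIntegral_add_eq t 0]
      have := hHq T ⟨hT.le, le_rfl⟩
      simp only [hH] at this
      rw [zero_add]; linarith
    have h2 := intervalIntegral.integral_add_adjacent_intervals
      (hGc.intervalIntegrable (μ := MeasureTheory.volume) 0 t) (hGc.intervalIntegrable t (t+T))
    simp only [hH]
    linarith
  have hHQ : H = Q := by
    funext t
    obtain ⟨y, hy, hy1⟩ := (hHp.sub hQp).exists_mem_Ico₀ hT t
    have hy' : y ∈ Icc 0 T := ⟨hy.1, hy.2.le⟩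
    have : H t - Q t = H y - Q y := hy1
    rw [hHq y hy', hQq y hy'] at this
    linarith
  rw [hHQ] at hHd
  exact ⟨Q, hHd, hQp, hQq⟩

lemma riccati_flow (A B C : ℝ → ℝ) (T M : ℝ) (hT : 0 < T) (hM : 0 < M)
    (hA : Continuous A) (hB : Continuous B) (hC : Continuous C)
    (hC0 : ∀ t, C t < 0) (hbar : ∀ t, 0 < A t * M ^ 2 - B t * M + C t)
    (a b c : ℝ) (ha : ∀ t, |A t| ≤ a) (hb : ∀ t, |B t| ≤ b) (hc : ∀ t, |C t| ≤ c) :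
    ∃ q : ℝ → ℝ,
    (∀ t ∈ Icc 0 T, HasDerivWithinAt q (A t * q t ^ 2 + B t * q t + C t) (Icc 0 T) t) ∧
    q 0 = q T ∧ ∀ t ∈ Icc 0 T, q t ≤ 0 := by
  have ha0 : 0 ≤ a := (abs_nonneg _).trans (ha 0)
  have hb0 : 0 ≤ b := (abs_nonneg _).trans (hb 0)
  have hc0 : 0 ≤ c := (abs_nonneg _).trans (hc 0)
  set k : ℝ → ℝ := fun x => max (-M) (min x 0) with hk
  have hk1 : ∀ x, |k x| ≤ M := by
    intro x
    rw [abs_le]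
    exact ⟨le_max_left _ _, max_le (by linarith) ((min_le_right _ _).trans hM.le)⟩
  have hkL : ∀ x y, |k x - k y| ≤ |x - y| := by
    intro x y
    calc |k x - k y| ≤ max |(-M) - (-M)| |min x 0 - min y 0| := abs_max_sub_max_le_max _ _ _ _
      _ = |min x 0 - min y 0| := by simp
      _ ≤ max |x - y| |0 - 0| := abs_min_sub_min_le_max _ _ _ _
      _ = |x - y| := by simp
  have hkid : ∀ x, -M ≤ x → x ≤ 0 → k x = x := by
    intro x h1 h2
    simp [hk, h1, h2]
  set F : ℝ → ℝ → ℝ := fun t x => A t * k x ^ 2 + B t * k x + C t with hF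
  have hK0 : 0 ≤ a * (2 * M) + b := by positivity
  have hL0 : 0 ≤ a * M ^ 2 + b * M + c := by positivity
  have hPL : IsPicardLindelof F (⟨0, le_rfl, hT.le⟩ : Icc (0:ℝ) T) (0:ℝ)
      ⟨(a * M ^ 2 + b * M + c) * T + M, by positivity⟩ ⟨M, hM.le⟩
      ⟨a * M ^ 2 + b * M + c, hL0⟩ ⟨a * (2 * M) + b, hK0⟩ := by
    constructor
    · intro t _
      apply LipschitzWith.lipschitzOnWith
      apply LipschitzWith.of_dist_le_mul
      intro x y
      rw [Real.dist_eq, Real.dist_eq]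
      show _ ≤ (a * (2 * M) + b) * |x - y|
      have : F t x - F t y = (A t * (k x + k y) + B t) * (k x - k y) := by
        simp only [hF]; ring
      rw [this, abs_mul]
      have h1 : |A t * (k x + k y) + B t| ≤ a * (2 * M) + b := by
        refine (abs_add_le _ _).trans (add_le_add ?_ (hb t))
        rw [abs_mul]
        refine mul_le_mul (ha t) ?_ (abs_nonneg _) ha0
        refine (abs_add_le _ _).trans ?_
        linarith [hk1 x, hk1 y]
      exact mul_le_mul h1 (hkL x y) (abs_nonneg _) hK0
    · intro x _
      apply Continuous.continuousOn
      simp only [hF]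
      fun_prop
    · intro t _ x _
      rw [Real.norm_eq_abs]
      show _ ≤ a * M ^ 2 + b * M + c
      refine (abs_add_le _ _).trans (add_le_add ?_ (hc t))
      refine (abs_add_le _ _).trans (add_le_add ?_ ?_)
      · rw [abs_mul, abs_pow]
        exact mul_le_mul (ha t) (pow_le_pow_left₀ (abs_nonneg _) (hk1 x) 2) (by positivity) ha0
      · rw [abs_mul]
        exact mul_le_mul (hb t) (hk1 x) (by positivity) hb0
    · show (a * M ^ 2 + b * M + c) * max (T - 0) (0 - 0)
        ≤ ((a * M ^ 2 + b * M + c) * T + M) - M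
      rw [sub_zero, sub_zero, max_eq_left hT.le]
      linarith
  obtain ⟨α, hα, L', hL'⟩ :=
    hPL.exists_forall_mem_closedBall_eq_hasDerivWithinAt_lipschitzOnWith
  have hball : Icc (-M) 0 ⊆ Metric.closedBall (0:ℝ) (⟨M, hM.le⟩ : NNReal) := by
    intro x hx
    rw [Metric.mem_closedBall, Real.dist_eq, sub_zero]
    show |x| ≤ M
    rw [abs_le]
    exact ⟨hx.1, hx.2.trans hM.le⟩
  have hinv : ∀ x ∈ Icc (-M) 0, ∀ t ∈ Icc 0 T, α x t ∈ Icc (-M) 0 := by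
    intro x hx t ht
    obtain ⟨h1, h2⟩ := hα x (hball hx)
    have h1 : α x 0 = x := h1
    have hcont : ContinuousOn (α x) (Icc 0 T) := fun t ht => (h2 t ht).continuousWithinAt
    have hder : ∀ s ∈ Ico 0 T, HasDerivWithinAt (α x) (F s (α x s)) (Ici s) s := by
      intro s hs
      exact (h2 s ⟨hs.1, hs.2.le⟩).mono_of_mem_nhdsWithin
        (mem_of_superset (Icc_mem_nhdsGE hs.2) (Icc_subset_Icc_left hs.1))
    constructor
    · have := image_le_of_deriv_right_lt_deriv_boundary' (f := fun s => - α x s)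
        (f' := fun s => - F s (α x s)) (B := fun _ => M) (B' := fun _ => 0) hcont.neg
        (fun s hs => (hder s hs).neg) (by simp only [h1]; linarith [hx.1]) continuousOn_const
        (fun s _ => hasDerivWithinAt_const _ _ _) ?_ ht
      · linarith
      · intro s _ hs
        have hs : α x s = -M := by linarith
        simp only [hF, hs, hkid (-M) le_rfl (by linarith)]
        linarith [hbar s]
    · refine image_le_of_deriv_right_lt_deriv_boundary' (f := fun s => α x s)
        (f' := fun s => F s (α x s)) (B := fun _ => 0) (B' := fun _ => 0) hcont
        hder (by simp only [h1]; exact hx.2) continuousOn_const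
        (fun s _ => hasDerivWithinAt_const _ _ _) ?_ ht
      intro s _ hs
      simp only [hF, hs, hkid 0 (by linarith) le_rfl]
      linarith [hC0 s]
  have hTm : T ∈ Icc 0 T := ⟨hT.le, le_rfl⟩
  obtain ⟨x, hx, hfix⟩ := exists_mem_Icc_isFixedPt_of_mapsTo (f := fun x => α x T)
    (((hL' T hTm).continuousOn).mono hball) (by linarith) (fun x hx => hinv x hx T hTm)
  obtain ⟨h1, h2⟩ := hα x (hball hx)
  refine ⟨α x, ?_, ?_, fun t ht => (hinv x hx t ht).2⟩
  · intro t ht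
    have := h2 t ht
    simp only [hF, hkid _ (hinv x hx t ht).1 (hinv x hx t ht).2] at this
    exact this
  · exact h1.trans hfix.symm

lemma riccati_exists_pos (A B C : ℝ → ℝ) (T : ℝ) (hT : 0 < T)
    (hA : Continuous A) (hB : Continuous B) (hC : Continuous C)
    (hAper : Function.Periodic A T) (hBper : Function.Periodic B T)
    (hCper : Function.Periodic C T) (hA0 : ∀ t, 0 < A t) (hC0 : ∀ t, C t < 0) :
    ∃ Q : ℝ → ℝ, (∀ t : ℝ, HasDerivAt Q (A t * Q t ^ 2 + B t * Q t + C t) t) ∧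
      Function.Periodic Q T ∧ ∀ t, Q t < 0 := by
  have bd : ∀ f : ℝ → ℝ, Continuous f → Function.Periodic f T → ∃ m, ∀ t, |f t| ≤ m := by
    intro f hf hp
    obtain ⟨m, hm⟩ := (hp.compact_of_continuous hT.ne' hf).isBounded.exists_norm_le
    exact ⟨m, fun t => hm _ ⟨t, rfl⟩⟩
  obtain ⟨a, ha⟩ := bd A hA hAper
  obtain ⟨b, hb⟩ := bd B hB hBper
  obtain ⟨c, hc⟩ := bd C hC hCper
  obtain ⟨a', ha'⟩ := bd (fun t => (A t)⁻¹) (hA.inv₀ fun t => (hA0 t).ne')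
    (fun t => by simp only [hAper t])
  have hb0 : 0 ≤ b := (abs_nonneg _).trans (hb 0)
  have hc0 : 0 ≤ c := (abs_nonneg _).trans (hc 0)
  have ha0 : 0 ≤ a' := (abs_nonneg _).trans (ha' 0)
  set M := (b + c + 1) * a' + 1 with hMdef
  have hM1 : 1 ≤ M := by
    have : 0 ≤ (b + c + 1) * a' := by positivity
    linarith
  have hbar : ∀ t, 0 < A t * M ^ 2 - B t * M + C t := by
    intro t
    have h1 : 1 ≤ A t * a' := by
      have := (le_abs_self _).trans (ha' t)
      calc 1 = A t * (A t)⁻¹ := (mul_inv_cancel₀ (hA0 t).ne').symm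
        _ ≤ _ := mul_le_mul_of_nonneg_left this (hA0 t).le
    have h2 : b + c + 1 ≤ A t * M := by
      have : (b + c + 1) * 1 ≤ (b + c + 1) * (A t * a') :=
        mul_le_mul_of_nonneg_left h1 (by linarith)
      have h3 := hA0 t
      rw [hMdef]; nlinarith
    have h3 := (abs_le.1 (hb t)).2
    have h4 := (abs_le.1 (hc t)).1
    have h5 : (c + 1) * M ≤ (A t * M - B t) * M :=
      mul_le_mul_of_nonneg_right (by linarith) (by linarith)
    nlinarith
  obtain ⟨q, hq, hq0, hqn⟩ := riccati_flow A B C T M hT (by linarith) hA hB hC hC0 hbar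
    a b c ha hb hc
  obtain ⟨Q, hQ, hQp, hQq⟩ := riccati_glue A B C q T hT hA hB hC hAper hBper hCper hq hq0
  have hle : ∀ t, Q t ≤ 0 := by
    intro t
    obtain ⟨y, hy, hy1⟩ := hQp.exists_mem_Ico₀ hT t
    rw [hy1, hQq y ⟨hy.1, hy.2.le⟩]
    exact hqn y ⟨hy.1, hy.2.le⟩
  refine ⟨Q, hQ, hQp, fun t => lt_of_le_of_ne (hle t) fun h => ?_⟩
  have hmax : IsLocalMax Q t := Eventually.of_forall fun s => by rw [h]; exact hle s
  have := hmax.hasDerivAt_eq_zero (hQ t)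
  rw [h] at this
  have := hC0 t
  linarith

lemma riccati_unique_le (A B C : ℝ → ℝ) (T : ℝ) (hT : 0 < T)
    (hAC : ∀ t : ℝ, 0 < -(A t * C t)) (P Q : ℝ → ℝ)
    (hP : ∀ t : ℝ, HasDerivAt P (A t * P t ^ 2 + B t * P t + C t) t)
    (hPp : Function.Periodic P T) (hPn : ∀ t, P t < 0)
    (hQ : ∀ t : ℝ, HasDerivAt Q (A t * Q t ^ 2 + B t * Q t + C t) t)
    (hQp : Function.Periodic Q T) (hQn : ∀ t, Q t < 0) (t : ℝ) : Q t ≤ P t := by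
  have hc : Continuous fun t => P t / Q t :=
    Continuous.div (continuous_iff_continuousAt.2 fun t => (hP t).continuousAt)
      (continuous_iff_continuousAt.2 fun t => (hQ t).continuousAt) fun t => (hQn t).ne
  have hp : Function.Periodic (fun t => P t / Q t) T := fun t => by simp only [hPp t, hQp t]
  obtain ⟨_, ⟨s, rfl⟩, hs⟩ := (hp.compact_of_continuous hT.ne' hc).exists_isGreatest
    (range_nonempty _)
  have hs' : ∀ t, P t / Q t ≤ P s / Q s := fun t => hs ⟨t, rfl⟩
  have hmax : IsLocalMax (fun t => P t / Q t) s := Eventually.of_forall hs'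
  have h0 := hmax.hasDerivAt_eq_zero ((hP s).div (hQ s) (hQn s).ne)
  have hPs := hPn s
  have hQs := hQn s
  have h1 : (P s - Q s) * (A s * (P s * Q s) - C s) = 0 := by
    rw [div_eq_zero_iff] at h0
    rcases h0 with h0 | h0
    · linarith
    · exact absurd h0 (pow_ne_zero 2 hQs.ne)
  have hpq : 0 < P s * Q s := mul_pos_of_neg_of_neg hPs hQs
  have h2 : A s * (P s * Q s) - C s ≠ 0 := by
    intro h
    have h3 : A s * C s = A s ^ 2 * (P s * Q s) := by
      have : C s = A s * (P s * Q s) := by linarith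
      rw [this]; ring
    have := hAC s
    have : 0 ≤ A s ^ 2 * (P s * Q s) := by positivity
    linarith
  have h3 : P s = Q s := by
    have := (mul_eq_zero.1 h1).resolve_right h2
    linarith
  have h4 := hs' t
  rw [h3, div_self hQs.ne, div_le_one_of_neg (hQn t)] at h4
  exact h4

/-- Kotin's theorem (negative solution): under the stated hypotheses the periodic
Riccati equation has exactly one negative `T`-periodic solution. -/
theorem riccati_existsUnique_negative_periodic_solution
    (A B C : ℝ → ℝ) (T : ℝ) (hT : 0 < T)
    (hA : ContDiff ℝ 1 A) (hB : Continuous B) (hC : Continuous C)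
    (hAper : Function.Periodic A T) (hBper : Function.Periodic B T)
    (hCper : Function.Periodic C T)
    (hAC : ∀ t : ℝ, 0 < -(A t * C t)) :
    ∃! Qm : ℝ → ℝ,
      (∀ t : ℝ, HasDerivAt Qm (A t * Qm t ^ 2 + B t * Qm t + C t) t) ∧
      Function.Periodic Qm T ∧ (∀ t : ℝ, Qm t < 0) := by
  have hAc := hA.continuous
  have hA0 : ∀ t, A t ≠ 0 := fun t h => by have := hAC t; simp [h] at this
  apply existsUnique_of_exists_of_unique
  · rcases lt_or_gt_of_ne (hA0 0) with h | h
    · have hneg : ∀ t, A t < 0 := by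
        intro t
        by_contra! ht
        obtain ⟨s, hs⟩ := mem_range_of_exists_le_of_exists_ge hAc ⟨0, h.le⟩ ⟨t, ht⟩
        exact hA0 s hs
      have hCp : ∀ t, 0 < C t := fun t => by
        have := hAC t; have := hneg t; by_contra! h; nlinarith
      have pr : ∀ f : ℝ → ℝ, Function.Periodic f T →
          Function.Periodic (fun t => - f (-t)) T := by
        intro f hf t
        show - f (-(t + T)) = - f (-t)
        rw [neg_add, ← sub_eq_add_neg, hf.sub_eq]
      obtain ⟨R, hR, hRp, hRn⟩ := riccati_exists_pos (fun t => - A (-t)) (fun t => - B (-t))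
        (fun t => - C (-t)) T hT (by fun_prop) (by fun_prop) (by fun_prop)
        (pr A hAper) (pr B hBper) (pr C hCper)
        (fun t => by linarith [hneg (-t)]) (fun t => by linarith [hCp (-t)])
      refine ⟨fun t => R (-t), fun t => ?_, fun t => ?_, fun t => hRn _⟩
      · have := (hR (-t)).comp t (hasDerivAt_neg t)
        convert! this using 1
        simp only [neg_neg]
        ring
      · show R (-(t + T)) = R (-t)
        rw [neg_add, ← sub_eq_add_neg, hRp.sub_eq]
    · have hpos : ∀ t, 0 < A t := by
        intro t
        by_contra! ht
        obtain ⟨s, hs⟩ := mem_range_of_exists_le_of_exists_ge hAc ⟨t, ht⟩ ⟨0, h.le⟩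
        exact hA0 s hs
      exact riccati_exists_pos A B C T hT hAc hB hC hAper hBper hCper hpos
        (fun t => by have := hAC t; have := hpos t; by_contra! h; nlinarith)
  · rintro P Q ⟨hP, hPp, hPn⟩ ⟨hQ, hQp, hQn⟩
    funext t
    exact le_antisymm (riccati_unique_le A B C T hT hAC Q P hQ hQp hQn hP hPp hPn t)
      (riccati_unique_le A B C T hT hAC P Q hP hPp hPn hQ hQp hQn t)
end

section
/- Suppose A is continuously differentiable, B and C are continuous, A, B, C are all T-periodic with T > 0, and -A(t)C(t) > 0 for every real t. Let Q₊ and Q₋ be the unique positive and negative T-periodic solutions of the Riccati equation Q'(t) = A(t)Q(t)² + B(t)Q(t) + C(t). Then every solution Q : ℝ → ℝ of the Riccati equation that is defined (and differentiable) on all of ℝ satisfies Q₋(t) ≤ Q(t) ≤ Q₊(t) for every t. -/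
lemma lin_pos (D p : ℝ → ℝ) (hp : Continuous p) (hD : ∀ t, HasDerivAt D (p t * D t) t)
    (t0 : ℝ) (h0 : 0 < D t0) (t : ℝ) : 0 < D t := by
  have hP : ∀ t, HasDerivAt (fun x => ∫ y in (0:ℝ)..x, p y) (p t) t := fun t =>
    intervalIntegral.integral_hasDerivAt_right (hp.intervalIntegrable _ _)
      (hp.stronglyMeasurableAtFilter _ _) hp.continuousAt
  set P := fun x => ∫ y in (0:ℝ)..x, p y with hPdef
  have hG : ∀ t, HasDerivAt (fun x => D x * Real.exp (-P x)) 0 t := fun t => by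
    have h2 : HasDerivAt (fun x => -P x) (-p t) t := (hP t).fun_neg
    exact ((hD t).fun_mul h2.exp).congr_deriv (by ring)
  have hc := is_const_of_deriv_eq_zero (fun t => (hG t).differentiableAt)
    (fun t => (hG t).deriv) t t0
  have h1 : 0 < D t0 * Real.exp (-P t0) := mul_pos h0 (Real.exp_pos _)
  have h2 : 0 < D t * Real.exp (-P t) := by
    have : D t * Real.exp (-P t) = D t0 * Real.exp (-P t0) := hc
    rw [this]; exact h1
  exact (mul_pos_iff_of_pos_right (Real.exp_pos _)).1 h2

lemma hits_zero (F g : ℝ → ℝ) (T : ℝ) (hT : 0 < T) (hF : ∀ t, HasDerivAt F (g t) t)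
    (hg : Function.Periodic g T) (hne : ∀ t, g t ≠ 0) : ∃ t, F t = 0 := by
  have hFc : Continuous F := continuous_iff_continuousAt.2 fun t => (hF t).continuousAt
  have hG : ∀ t, HasDerivAt (fun x => F (x + T) - F x) 0 t := fun t => by
    have := ((hF (t + T)).comp_add_const t T).sub (hF t)
    rw [hg t, sub_self] at this
    exact this
  have hc : ∀ t, F (t + T) - F t = F (0 + T) - F 0 := fun t =>
    is_const_of_deriv_eq_zero (fun t => (hG t).differentiableAt)
      (fun t => (hG t).deriv) t 0
  set k := F (0 + T) - F 0 with hk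
  have hk0 : k ≠ 0 := by
    obtain ⟨c, -, h⟩ := exists_hasDerivAt_eq_slope F g (show (0:ℝ) < 0 + T by simpa using hT)
      hFc.continuousOn (fun x _ => hF x)
    intro h0
    apply hne c
    rw [h, ← hk, h0, zero_div]
  have hup : ∀ (n : ℕ) (s : ℝ), F (s + n * T) = F s + n * k := by
    intro n s
    induction n with
    | zero => simp
    | succ m ih =>
      have := hc (s + m * T)
      push_cast
      rw [show s + ((m:ℝ) + 1) * T = s + m * T + T by ring]
      linarith
  obtain ⟨n, hn⟩ := exists_nat_ge (|F 0| / |k|)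
  have hkp : 0 < |k| := abs_pos.2 hk0
  rw [div_le_iff₀ hkp] at hn
  have e1 := hup n 0
  have e2 := hup n (-(n * T))
  rw [neg_add_cancel] at e2
  have h1 := le_abs_self (F 0)
  have h2 := neg_abs_le (F 0)
  have key : ∃ a b, F a ≤ 0 ∧ 0 ≤ F b := by
    rcases abs_cases k with ⟨h, _⟩ | ⟨h, _⟩ <;> rw [h] at hn
    · exact ⟨-(n * T), 0 + n * T, by linarith, by linarith⟩
    · exact ⟨0 + n * T, -(n * T), by linarith, by linarith⟩
  obtain ⟨a, b, ha, hb⟩ := key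
  exact mem_range_of_exists_le_of_exists_ge hFc ⟨a, ha⟩ ⟨b, hb⟩

/-- Kotin's theorem (comparison part): every globally defined solution of the
periodic Riccati equation lies between the negative and the positive
`T`-periodic solutions. -/
theorem riccati_global_solution_between_periodic_solutions
    (A B C : ℝ → ℝ) (T : ℝ) (hT : 0 < T)
    (hA : ContDiff ℝ 1 A) (hB : Continuous B) (hC : Continuous C)
    (hAper : Function.Periodic A T) (hBper : Function.Periodic B T)
    (hCper : Function.Periodic C T)
    (hAC : ∀ t : ℝ, 0 < -(A t * C t))
    (Qp Qm : ℝ → ℝ)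
    (hQp : ∀ t : ℝ, HasDerivAt Qp (A t * Qp t ^ 2 + B t * Qp t + C t) t)
    (hQpper : Function.Periodic Qp T) (hQppos : ∀ t : ℝ, 0 < Qp t)
    (hQm : ∀ t : ℝ, HasDerivAt Qm (A t * Qm t ^ 2 + B t * Qm t + C t) t)
    (hQmper : Function.Periodic Qm T) (hQmneg : ∀ t : ℝ, Qm t < 0)
    (Q : ℝ → ℝ)
    (hQ : ∀ t : ℝ, HasDerivAt Q (A t * Q t ^ 2 + B t * Q t + C t) t) :
    ∀ t : ℝ, Qm t ≤ Q t ∧ Q t ≤ Qp t := by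
  have hc : ∀ {f f' : ℝ → ℝ}, (∀ t, HasDerivAt f (f' t) t) → Continuous f := fun h =>
    continuous_iff_continuousAt.2 fun t => (h t).continuousAt
  have hQc := hc hQ
  have hQpc := hc hQp
  have hQmc := hc hQm
  have hAc := hA.continuous
  intro t0
  by_contra hcon
  have h0 : 0 < (Q t0 - Qp t0) * (Q t0 - Qm t0) := by
    have hp := hQppos t0
    have hm := hQmneg t0
    by_contra hle
    apply hcon
    constructor <;> nlinarith
  have hD : ∀ t, HasDerivAt (fun t => Q t - Qp t) ((A t * (Q t + Qp t) + B t) * (Q t - Qp t)) t :=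
    fun t => ((hQ t).sub (hQp t)).congr_deriv (by ring)
  have hE : ∀ t, HasDerivAt (fun t => Q t - Qm t) ((A t * (Q t + Qm t) + B t) * (Q t - Qm t)) t :=
    fun t => ((hQ t).sub (hQm t)).congr_deriv (by ring)
  have hpos := lin_pos (fun t => (Q t - Qp t) * (Q t - Qm t))
    (fun t => (A t * (Q t + Qp t) + B t) + (A t * (Q t + Qm t) + B t)) (by fun_prop)
    (fun t => ((hD t).mul (hE t)).congr_deriv (by ring)) t0 h0
  have hDne : ∀ t, Q t - Qp t ≠ 0 := fun t => left_ne_zero_of_mul (hpos t).ne'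
  have hEne : ∀ t, Q t - Qm t ≠ 0 := fun t => right_ne_zero_of_mul (hpos t).ne'
  obtain ⟨t, ht⟩ := hits_zero (fun t => Real.log (Q t - Qp t) - Real.log (Q t - Qm t))
    (fun t => A t * (Qp t - Qm t)) T hT
    (fun t => (((hD t).log (hDne t)).sub ((hE t).log (hEne t))).congr_deriv (by
      rw [mul_div_cancel_right₀ _ (hDne t), mul_div_cancel_right₀ _ (hEne t)]; ring))
    (fun t => by simp only [hAper t, hQpper t, hQmper t])
    (fun t => by
      have hp := hQppos t
      have hm := hQmneg t
      refine mul_ne_zero (fun h => ?_) (by linarith)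
      have := hAC t
      simp [h] at this)
  have hp := hQppos t
  have hm := hQmneg t
  have hq : 0 < (Q t - Qp t) * (Q t - Qm t) := hpos t
  have hab : |Q t - Qp t| = |Q t - Qm t| := by
    apply Real.log_injOn_pos (abs_pos.2 (hDne t)) (abs_pos.2 (hEne t))
    rw [Real.log_abs, Real.log_abs]
    exact sub_eq_zero.1 ht
  rcases abs_eq_abs.1 hab with h | h
  · linarith
  · rw [h] at hq
    nlinarith [sq_nonneg (Q t - Qm t)]
end

section
/- Suppose A is continuously differentiable, B and C are continuous, A, B, C are all T-periodic with T > 0, and -A(t)C(t) > 0 for every real t. Let Q₊ and Q₋ be the unique positive and negative T-periodic solutions of the Riccati equation Q'(t) = A(t)Q(t)² + B(t)Q(t) + C(t). Then every solution Q : ℝ → ℝ of the Riccati equation defined on all of ℝ satisfies either Q(t) − Q₊(t) → 0 as t → ∞, or Q(t) − Q₋(t) → 0 as t → ∞. -/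
theorem riccati_aux
    (A B C : ℝ → ℝ) (T : ℝ) (hT : 0 < T)
    (hA : Continuous A) (hB : Continuous B)
    (hAper : Function.Periodic A T)
    (P R : ℝ → ℝ)
    (hP : ∀ t : ℝ, HasDerivAt P (A t * P t ^ 2 + B t * P t + C t) t)
    (hPper : Function.Periodic P T)
    (hR : ∀ t : ℝ, HasDerivAt R (A t * R t ^ 2 + B t * R t + C t) t)
    (hRper : Function.Periodic R T)
    (hneg : ∀ t, A t * (P t - R t) < 0)
    (Q : ℝ → ℝ)
    (hQ : ∀ t : ℝ, HasDerivAt Q (A t * Q t ^ 2 + B t * Q t + C t) t) :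
    Filter.Tendsto (fun t => Q t - P t) Filter.atTop (nhds 0) ∨
    Filter.Tendsto (fun t => Q t - R t) Filter.atTop (nhds 0) := by
  have cP : Continuous P := continuous_iff_continuousAt.2 fun t => (hP t).continuousAt
  have cR : Continuous R := continuous_iff_continuousAt.2 fun t => (hR t).continuousAt
  have cQ : Continuous Q := continuous_iff_continuousAt.2 fun t => (hQ t).continuousAt
  by_cases hz : ∃ t0, Q t0 - R t0 = 0
  · right
    obtain ⟨t0, h0⟩ := hz
    have cg : Continuous fun s => A s * (Q s + R s) + B s := by fun_prop
    have key : ∀ t, HasDerivAt (fun t => (Q t - R t) *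
        Real.exp (-(∫ s in (0:ℝ)..t, (A s * (Q s + R s) + B s)))) 0 t := by
      intro t
      have hI : HasDerivAt (fun t => ∫ s in (0:ℝ)..t, (A s * (Q s + R s) + B s))
          (A t * (Q t + R t) + B t) t := cg.integral_hasStrictDerivAt 0 t |>.hasDerivAt
      have := ((hQ t).sub (hR t)).mul hI.neg.exp
      refine this.congr_deriv ?_
      simp only [Pi.sub_apply, Pi.neg_apply]
      ring
    have hc := fun t => is_const_of_deriv_eq_zero (fun t => (key t).differentiableAt)
      (fun t => (key t).deriv) t t0
    have : (fun t => Q t - R t) = fun _ => 0 := by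
      funext t
      have h := hc t
      simp only [h0, zero_mul] at h
      exact (mul_eq_zero.1 h).resolve_right (Real.exp_pos _).ne'
    rw [this]
    exact tendsto_const_nhds
  · left
    push Not at hz
    -- delta
    obtain ⟨δ, hδ, hle⟩ : ∃ δ > 0, ∀ t, A t * (P t - R t) ≤ -δ := by
      have cf : Continuous fun t => A t * (P t - R t) := by fun_prop
      obtain ⟨x, -, hx⟩ := (isCompact_Icc (a := (0:ℝ)) (b := T)).exists_isMaxOn
        (Set.nonempty_Icc.2 hT.le) cf.continuousOn
      refine ⟨-(A x * (P x - R x)), by linarith [hneg x], fun t => ?_⟩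
      have pf : Function.Periodic (fun t => A t * (P t - R t)) T := by
        intro t; simp only [hAper t, hPper t, hRper t]
      obtain ⟨y, hy, hty⟩ := pf.exists_mem_Ico₀ hT t
      have := hx (Set.Ico_subset_Icc_self hy)
      simp only [Set.mem_ofPred_eq] at this hty
      linarith
    obtain ⟨M, hM⟩ : ∃ M, ∀ t, |P t - R t| ≤ M := by
      have cf : Continuous fun t => |P t - R t| := by fun_prop
      obtain ⟨x, -, hx⟩ := (isCompact_Icc (a := (0:ℝ)) (b := T)).exists_isMaxOn
        (Set.nonempty_Icc.2 hT.le) cf.continuousOn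
      refine ⟨|P x - R x|, fun t => ?_⟩
      have pf : Function.Periodic (fun t => |P t - R t|) T := by
        intro t; simp only [hPper t, hRper t]
      obtain ⟨y, hy, hty⟩ := pf.exists_mem_Ico₀ hT t
      have := hx (Set.Ico_subset_Icc_self hy)
      simp only [Set.mem_ofPred_eq] at this hty
      linarith
    set w : ℝ → ℝ := fun t => (Q t - P t) / (Q t - R t) with hw
    have dw : ∀ t, HasDerivAt w (A t * (P t - R t) * w t) t := by
      intro t
      refine (((hQ t).sub (hP t)).div ((hQ t).sub (hR t)) (hz t)).congr_deriv ?_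
      have := hz t
      simp only [hw, Pi.sub_apply]
      field_simp
      ring
    have dF : ∀ t, HasDerivAt (fun t => w t ^ 2 * Real.exp (2 * δ * t))
        (2 * (A t * (P t - R t) + δ) * (w t ^ 2 * Real.exp (2 * δ * t))) t := by
      intro t
      have he : HasDerivAt (fun t : ℝ => Real.exp (2 * δ * t))
          (Real.exp (2 * δ * t) * (2 * δ * 1)) t := ((hasDerivAt_id t).const_mul (2 * δ)).exp
      refine (((dw t).pow 2).mul he).congr_deriv ?_
      simp only [Pi.pow_apply]
      push_cast
      ring
    have anti : Antitone (fun t => w t ^ 2 * Real.exp (2 * δ * t)) := by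
      refine antitone_of_deriv_nonpos (fun t => (dF t).differentiableAt) fun t => ?_
      rw [(dF t).deriv]
      have := hle t
      exact mul_nonpos_of_nonpos_of_nonneg (by linarith) (by positivity)
    have w2 : Filter.Tendsto (fun t => w t ^ 2) Filter.atTop (nhds 0) := by
      have hexp : Filter.Tendsto (fun t : ℝ => w 0 ^ 2 * Real.exp (-(2 * δ * t)))
          Filter.atTop (nhds 0) := by
        have h1 : Filter.Tendsto (fun t : ℝ => 2 * δ * t) Filter.atTop Filter.atTop :=
          Filter.tendsto_id.const_mul_atTop (by linarith)
        simpa using (Real.tendsto_exp_neg_atTop_nhds_zero.comp h1).const_mul (w 0 ^ 2)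
      refine squeeze_zero' (Filter.Eventually.of_forall fun t => sq_nonneg _) ?_ hexp
      filter_upwards [Filter.eventually_ge_atTop 0] with t ht
      have := anti ht
      simp only [mul_zero, Real.exp_zero, mul_one] at this
      rw [Real.exp_neg, ← div_eq_mul_inv, le_div_iff₀ (Real.exp_pos _)]
      exact this
    have w1 : Filter.Tendsto w Filter.atTop (nhds 0) := by
      have := w2.sqrt
      simp only [Real.sqrt_sq_eq_abs, Real.sqrt_zero] at this
      exact (tendsto_zero_iff_abs_tendsto_zero _).2 this
    have wD : Filter.Tendsto (fun t => w t * (P t - R t)) Filter.atTop (nhds 0) := by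
      refine squeeze_zero_norm (a := fun t => |w t| * M) (fun t => ?_) ?_
      · rw [Real.norm_eq_abs, abs_mul]
        exact mul_le_mul_of_nonneg_left (hM t) (abs_nonneg _)
      · simpa using w1.abs.mul_const M
    have h1 : Filter.Tendsto (fun t => 1 - w t) Filter.atTop (nhds 1) := by
      simpa using w1.const_sub 1
    have fin := wD.div h1 one_ne_zero
    rw [zero_div] at fin
    refine fin.congr fun t => ?_
    have hv := hz t
    have hD : P t - R t ≠ 0 := fun h => by have := hneg t; simp [h] at this
    have h1w : 1 - w t = (P t - R t) / (Q t - R t) := by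
      simp only [hw]; field_simp; ring
    simp only [Pi.div_apply]
    rw [h1w]
    simp only [hw]
    field_simp


/-- Kotin's theorem (asymptotic part): every globally defined solution of the
periodic Riccati equation is asymptotic, as `t → ∞`, either to the positive or
to the negative `T`-periodic solution. -/
theorem riccati_global_solution_asymptotic
    (A B C : ℝ → ℝ) (T : ℝ) (hT : 0 < T)
    (hA : ContDiff ℝ 1 A) (hB : Continuous B) (hC : Continuous C)
    (hAper : Function.Periodic A T) (hBper : Function.Periodic B T)
    (hCper : Function.Periodic C T)
    (hAC : ∀ t : ℝ, 0 < -(A t * C t))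
    (Qp Qm : ℝ → ℝ)
    (hQp : ∀ t : ℝ, HasDerivAt Qp (A t * Qp t ^ 2 + B t * Qp t + C t) t)
    (hQpper : Function.Periodic Qp T) (hQppos : ∀ t : ℝ, 0 < Qp t)
    (hQm : ∀ t : ℝ, HasDerivAt Qm (A t * Qm t ^ 2 + B t * Qm t + C t) t)
    (hQmper : Function.Periodic Qm T) (hQmneg : ∀ t : ℝ, Qm t < 0)
    (Q : ℝ → ℝ)
    (hQ : ∀ t : ℝ, HasDerivAt Q (A t * Q t ^ 2 + B t * Q t + C t) t) :
    Filter.Tendsto (fun t => Q t - Qp t) Filter.atTop (nhds 0) ∨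
    Filter.Tendsto (fun t => Q t - Qm t) Filter.atTop (nhds 0) := by

  have hA0 : ∀ t, A t ≠ 0 := fun t h => by have := hAC t; simp [h] at this
  by_cases hs : ∃ a, 0 < A a
  · obtain ⟨a, ha⟩ := hs
    have hpos : ∀ t, 0 < A t := by
      intro t
      by_contra hn
      obtain ⟨x, hx⟩ := mem_range_of_exists_le_of_exists_ge hA.continuous
        ⟨t, not_lt.1 hn⟩ ⟨a, ha.le⟩
      exact hA0 x hx
    refine (riccati_aux A B C T hT hA.continuous hB hAper Qm Qp hQm hQmper hQp hQpper
      (fun t => ?_) Q hQ).symm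
    exact mul_neg_of_pos_of_neg (hpos t) (by linarith [hQppos t, hQmneg t])
  · push Not at hs
    refine riccati_aux A B C T hT hA.continuous hB hAper Qp Qm hQp hQpper hQm hQmper
      (fun t => ?_) Q hQ
    exact mul_neg_of_neg_of_pos (lt_of_le_of_ne (hs t) (hA0 t))
      (by linarith [hQppos t, hQmneg t])
end

section
/- Let A, B, C : ℝ → ℝ be continuous with C(t) < 0 for all t, let I ⊆ ℝ be an interval, and let Q : I → ℝ be a solution of the Riccati equation Q'(t) = A(t)Q(t)² + B(t)Q(t) + C(t) on I. If t₀ ∈ I and Q(t₀) ≤ 0, then Q(t) < 0 for every t ∈ I with t > t₀. In particular, no solution that is ever nonpositive can converge to a solution that is everywhere positive. -/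
/-- If `C < 0` everywhere and a solution of the Riccati equation on an interval
`I` is nonpositive at some `t₀ ∈ I`, then it is strictly negative at every
later point of `I`. -/
theorem riccati_stays_negative
    (A B C : ℝ → ℝ) (hA : Continuous A) (hB : Continuous B) (hC : Continuous C)
    (hCneg : ∀ t : ℝ, C t < 0)
    (I : Set ℝ) (hI : I.OrdConnected)
    (Q : ℝ → ℝ)
    (hQ : ∀ t ∈ I, HasDerivWithinAt Q (A t * Q t ^ 2 + B t * Q t + C t) I t)
    (t₀ : ℝ) (ht₀ : t₀ ∈ I) (hQt₀ : Q t₀ ≤ 0) :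
    ∀ t ∈ I, t₀ < t → Q t < 0 := by
  intro t ht htt
  have hsub : Set.Icc t₀ t ⊆ I := hI.out ht₀ ht
  have hle : ∀ ⦃x⦄, x ∈ Set.Icc t₀ t → Q x ≤ 0 := by
    refine image_le_of_deriv_right_lt_deriv_boundary' (f := Q)
      (f' := fun x => A x * Q x ^ 2 + B x * Q x + C x) (B := fun _ => 0) (B' := fun _ => 0)
      ?_ ?_ hQt₀ continuousOn_const (fun x _ => hasDerivWithinAt_const _ _ _) ?_
    · exact fun x hx => ((hQ x (hsub hx)).continuousWithinAt).mono hsub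
    · intro x hx
      refine ((hQ x (hsub ⟨hx.1, hx.2.le⟩)).mono hsub).mono_of_mem_nhdsWithin ?_
      exact Filter.mem_of_superset (Icc_mem_nhdsGE hx.2) (Set.Icc_subset_Icc_left hx.1)
    · intro x _ h0
      have h0 : Q x = 0 := h0
      simpa [h0] using hCneg x
  refine lt_of_le_of_ne (hle ⟨htt.le, le_rfl⟩) fun h0 => ?_
  have hd : HasDerivWithinAt Q (C t) (Set.Iio t) t := by
    have h := (hQ t ht).mono (Set.Ico_subset_Icc_self.trans hsub)
    have h := h.mono_of_mem_nhdsWithin (Ico_mem_nhdsLT htt)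
    simpa [h0] using h
  rw [hasDerivWithinAt_iff_tendsto_slope' (by simp)] at hd
  obtain ⟨x, hx, hx'⟩ := ((hd.eventually_lt_const (hCneg t)).and (Ico_mem_nhdsLT htt)).exists
  have hxQ := hle ⟨hx'.1, hx'.2.le⟩
  rw [slope_def_field, h0] at hx
  have := div_nonneg_of_nonpos (a := Q x - 0) (b := x - t) (by linarith) (by linarith [hx'.2])
  linarith
end
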